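/- For every k ≥ 0, there is a legal play P_0, …, P_L of the pebble game of length 2^k − 1 (starting from the empty position P_0 = ∅, not required to end empty) that uses at most k pebbles, consists of exactly L = (3^k − 1)/2 moves, and whose final position P_L has exactly k elements and contains the last node 2^k − 1 (for k ≥ 1). This is the correctness and step count of the recursive procedure F(k) of Bennett's pebbling strategy. -/

import Mathlib

/-- A single legal move of the pebble game on nodes `1,…,T`: a pebble is put on or
removed from a node `i ∈ {1,…,T}`, subject to the rule that if `i > 1` then node
`i - 1` must carry a pebble at the time. -/
def PebbleStep (T : ℕ) (Q R : Finset ℕ) : Prop :=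
  ∃ i : ℕ, 1 ≤ i ∧ i ≤ T ∧ (1 < i → i - 1 ∈ Q) ∧
    ((i ∉ Q ∧ R = insert i Q) ∨ (i ∈ Q ∧ R = Q.erase i))

/-- A play of the pebble game of length `T`: a finite sequence of positions
`P_0, P_1, …, P_L` starting from the empty position `P_0 = ∅`, each next position
obtained from the previous one by a legal move. -/
def IsPlay (T : ℕ) (P : List (Finset ℕ)) : Prop :=
  P.head? = some ∅ ∧ List.Chain' (PebbleStep T) P

/-- The play uses at most `n` pebbles: every position has at most `n` pebbles on the board. -/
def UsesAtMost (n : ℕ) (P : List (Finset ℕ)) : Prop :=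
  ∀ Q ∈ P, Q.card ≤ n

/-- The play is winning: node `T` is pebbled at some time and the final position is empty. -/
def IsWinning (T : ℕ) (P : List (Finset ℕ)) : Prop :=
  (∃ Q ∈ P, T ∈ Q) ∧ P.getLast? = some ∅


/-- `PebbleWalk T n L A B`: `L` legal moves lead from position `A` to position `B`, every
position on the way having at most `n` pebbles. -/
inductive PebbleWalk (T n : ℕ) : ℕ → Finset ℕ → Finset ℕ → Prop
  | refl {A : Finset ℕ} (h : A.card ≤ n) : PebbleWalk T n 0 A A
  | cons {L : ℕ} {A B C : Finset ℕ} (h : A.card ≤ n) (s : PebbleStep T A B)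
      (w : PebbleWalk T n L B C) : PebbleWalk T n (L + 1) A C

theorem PebbleStep.symm {T : ℕ} {A B : Finset ℕ} (h : PebbleStep T A B) :
    PebbleStep T B A := by
  obtain ⟨i, h1, hT, hp, ⟨hi, rfl⟩ | ⟨hi, rfl⟩⟩ := h
  · exact ⟨i, h1, hT, fun h => Finset.mem_insert_of_mem (hp h),
      Or.inr ⟨Finset.mem_insert_self _ _, (Finset.erase_insert hi).symm⟩⟩
  · exact ⟨i, h1, hT, fun h => Finset.mem_erase.2 ⟨by omega, hp h⟩,
      Or.inl ⟨Finset.notMem_erase _ _, (Finset.insert_erase hi).symm⟩⟩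

namespace PebbleWalk

variable {T n L M : ℕ} {A B C : Finset ℕ}

theorem mono {n' : ℕ} (hn : n ≤ n') (w : PebbleWalk T n L A B) : PebbleWalk T n' L A B := by
  induction w with
  | refl h => exact .refl (h.trans hn)
  | cons h s _ ih => exact .cons (h.trans hn) s ih

theorem card_left_le (w : PebbleWalk T n L A B) : A.card ≤ n := by
  cases w <;> assumption

theorem trans (w : PebbleWalk T n L A B) (v : PebbleWalk T n M B C) :
    PebbleWalk T n (L + M) A C := by
  induction w with
  | refl h => simpa using v
  | cons h s _ ih =>
    rw [Nat.add_right_comm]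
    exact .cons h s (ih v)

theorem symm (w : PebbleWalk T n L A B) : PebbleWalk T n L B A := by
  induction w with
  | refl h => exact .refl h
  | cons h s w ih => exact ih.trans (.cons w.card_left_le s.symm (.refl h))

theorem exists_list (w : PebbleWalk T n L A B) :
    ∃ P : List (Finset ℕ), P.head? = some A ∧ List.IsChain (PebbleStep T) P ∧
      UsesAtMost n P ∧ P.length = L + 1 ∧ P.getLast? = some B := by
  induction w with
  | @refl A h => exact ⟨[A], by simp [UsesAtMost, h]⟩
  | @cons L A B C h s _ ih =>
    obtain ⟨P, hh, hc, hu, hl, hg⟩ := ih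
    refine ⟨A :: P, rfl, ?_, ?_, by simp [hl], by simp [List.getLast?_cons, hg]⟩
    · rw [List.isChain_cons]
      refine ⟨fun y hy => ?_, hc⟩
      rw [hh] at hy
      cases hy
      exact s
    · intro Q hQ
      rcases List.mem_cons.1 hQ with rfl | hQ
      exacts [h, hu Q hQ]

end PebbleWalk

/-- Bennett's procedure run above node `m`, in the presence of a frame `B` of pebbles that stay
in place. -/
theorem exists_bennett_config (k m : ℕ) :
    ∃ C : Finset ℕ, (∀ x ∈ C, m < x ∧ x < m + 2 ^ k) ∧ C.card = k ∧
      (1 ≤ k → m + 2 ^ k - 1 ∈ C) ∧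
      ∀ (T : ℕ) (B : Finset ℕ), m + 2 ^ k ≤ T + 1 → (∀ x ∈ B, x ≤ m ∨ m + 2 ^ k ≤ x) →
        (0 < m → m ∈ B) → PebbleWalk T (B.card + k) ((3 ^ k - 1) / 2) B (B ∪ C) := by
  induction k generalizing m with
  | zero => exact ⟨∅, by simp, by simp, by simp, fun T B _ _ _ => by simpa using .refl le_rfl⟩
  | succ k ih =>
    obtain ⟨C, hC, hCk, hCl, hCw⟩ := ih m
    obtain ⟨D, hD, hDk, hDl, hDw⟩ := ih (m + 2 ^ k)
    have hpos : 0 < 2 ^ k := by positivity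
    have hpow : 2 ^ (k + 1) = 2 ^ k + 2 ^ k := by ring
    have hmD : m + 2 ^ k ∉ D := fun h => by have := hD _ h; omega
    refine ⟨insert (m + 2 ^ k) D, ?_, by rw [Finset.card_insert_of_notMem hmD, hDk], ?_, ?_⟩
    · intro x hx
      rcases Finset.mem_insert.1 hx with rfl | hx
      · omega
      · have := hD _ hx
        omega
    · intro _
      rcases Nat.eq_zero_or_pos k with rfl | hk
      · simp
      · rw [hpow, ← Nat.add_assoc]
        exact Finset.mem_insert_of_mem (hDl hk)
    · intro T B hT hB hm
      have hmB : m + 2 ^ k ∉ B := fun h => by have := hB _ h; omega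
      have hmC : m + 2 ^ k ∉ C := fun h => by have := hC _ h; omega
      have hcard : (insert (m + 2 ^ k) B).card + k = B.card + (k + 1) := by
        rw [Finset.card_insert_of_notMem hmB]
        omega
      have w₁ := (hCw T B (by omega) (fun x hx => by have := hB x hx; omega) hm).mono
        (show B.card + k ≤ B.card + (k + 1) by omega)
      have w₂ := hCw T (insert (m + 2 ^ k) B) (by omega)
        (fun x hx => by
          rcases Finset.mem_insert.1 hx with rfl | hx
          · omega
          · have := hB x hx
            omega)
        (fun h => Finset.mem_insert_of_mem (hm h))
      have w₃ := hDw T (insert (m + 2 ^ k) B) (by omega)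
        (fun x hx => by
          rcases Finset.mem_insert.1 hx with rfl | hx
          · omega
          · have := hB x hx
            omega)
        (fun _ => Finset.mem_insert_self _ _)
      rw [hcard] at w₂ w₃
      have s : PebbleStep T (B ∪ C) (insert (m + 2 ^ k) B ∪ C) := by
        refine ⟨m + 2 ^ k, by omega, by omega, fun h => ?_, Or.inl ⟨?_, ?_⟩⟩
        · rcases Nat.eq_zero_or_pos k with rfl | hk
          · exact Finset.mem_union_left _ (hm (by simpa using h))
          · exact Finset.mem_union_right _ (hCl hk)
        · simp [hmB, hmC]
        · rw [Finset.insert_union]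
      have w := w₁.trans ((PebbleWalk.cons w₁.symm.card_left_le s w₂.symm).trans w₃)
      rw [Finset.insert_union, ← Finset.union_insert] at w
      have hodd : 3 ^ k % 2 = 1 := by simp [Nat.pow_mod]
      convert w using 1
      rw [pow_succ]
      omega

/-- Correctness and step count of the recursive procedure `F(k)` of Bennett's pebbling
strategy: for every `k ≥ 0` there is a legal play of the pebble game of length `2^k - 1`
(starting from the empty position, not required to end empty) that uses at most `k`
pebbles, consists of exactly `(3^k - 1)/2` moves, and whose final position has exactly
`k` pebbles, among them one on the last node `2^k - 1` (when `k ≥ 1`). -/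
theorem bennett_F_correctness (k : ℕ) :
    ∃ P : List (Finset ℕ),
      IsPlay (2 ^ k - 1) P ∧ UsesAtMost k P ∧
      P.length = (3 ^ k - 1) / 2 + 1 ∧
      ∃ Q : Finset ℕ, P.getLast? = some Q ∧ Q.card = k ∧ (1 ≤ k → 2 ^ k - 1 ∈ Q) := by
  obtain ⟨C, -, hCk, hCl, hCw⟩ := exists_bennett_config k 0
  have w := hCw (2 ^ k - 1) ∅ (by omega) (by simp) (by simp)
  simp only [Finset.card_empty, Nat.zero_add, Finset.empty_union] at w
  obtain ⟨P, hh, hc, hu, hl, hg⟩ := w.exists_list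
  exact ⟨P, ⟨hh, hc⟩, hu, hl, C, hg, hCk, by simpa using hCl⟩
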